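/- Let μ₀ ∈ ℝ be not an eigenvalue of T and let ρ > 0 be such that every eigenvalue ν of T with ν ∉ S satisfies |μ₀ − ν| ≥ ρ/2. Let u₀ ∈ V with ‖u₀‖ = 1 and dist(u₀, E) ≤ 1/2, and let u' ∈ V satisfy (μ₀·id − T)·u' = u₀. Then u' ≠ 0, and the normalized vector u = u'/‖u'‖ satisfies dist(u, E) ≤ (4/ρ)·(max_{ν∈S} |μ₀ − ν|)·dist(u₀, E). (Abstract form of Lemma 2.4: the key contraction property of one step of shifted inverse iteration toward the cluster S of eigenvalues.) -/

import Mathlib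

open RealInnerProductSpace

/-- Squared distance to a sum of eigenspaces, in coordinates of an orthonormal eigenbasis. -/
theorem infDist_sq_iSup_eigenspace {V ι : Type*} [NormedAddCommGroup V] [InnerProductSpace ℝ V]
    [FiniteDimensional ℝ V] [Fintype ι] {T : V →ₗ[ℝ] V} (hT : T.IsSymmetric) (S : Finset ℝ)
    (b : OrthonormalBasis ι ℝ V) (l : ι → ℝ) (hb : ∀ i, T (b i) = l i • b i) (x : V) :
    Metric.infDist x ((⨆ ν ∈ S, Module.End.eigenspace T ν : Submodule ℝ V) : Set V) ^ 2 =
      ∑ i with l i ∉ S, ⟪b i, x⟫ ^ 2 := by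
  set E : Submodule ℝ V := ⨆ ν ∈ S, Module.End.eigenspace T ν
  have h_mem : ∀ i, l i ∈ S → b i ∈ E := fun i hi ↦
    (le_iSup₂_of_le (f := fun ν (_ : ν ∈ S) ↦ Module.End.eigenspace T ν) (l i) hi le_rfl)
      (Module.End.mem_eigenspace_iff.2 (hb i))
  have h_orth : ∀ i, l i ∉ S → b i ∈ Eᗮ := by
    intro i hi
    suffices E ≤ (ℝ ∙ b i)ᗮ from (Submodule.mem_orthogonal' E _).2 fun v hv ↦
      Submodule.mem_orthogonal_singleton_iff_inner_right.1 (this hv)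
    refine iSup₂_le fun ν hν v hv ↦ Submodule.mem_orthogonal_singleton_iff_inner_left.2 ?_
    rw [Module.End.mem_eigenspace_iff] at hv
    have h := hT v (b i)
    rw [hv, hb, real_inner_smul_left, real_inner_smul_right] at h
    have h_ne : ν - l i ≠ 0 := sub_ne_zero.2 fun h ↦ hi (h ▸ hν)
    exact (mul_eq_zero.1 (by linarith : (ν - l i) * ⟪v, b i⟫ = 0)).resolve_left h_ne
  set y : V := ∑ i with l i ∈ S, ⟪b i, x⟫ • b i
  have hxy : x - y = ∑ i with l i ∉ S, ⟪b i, x⟫ • b i := by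
    rw [sub_eq_iff_eq_add', Finset.sum_filter_add_sum_filter_not, b.sum_repr']
  have hyE : y ∈ E := Submodule.sum_mem _ fun i hi ↦
    E.smul_mem _ (h_mem i (Finset.mem_filter.1 hi).2)
  have hxyE : x - y ∈ Eᗮ := hxy ▸ Submodule.sum_mem _ fun i hi ↦
    Eᗮ.smul_mem _ (h_orth i (Finset.mem_filter.1 hi).2)
  have h_dist : Metric.infDist x (E : Set V) = ‖x - y‖ := by
    rw [Metric.infDist_eq_iInf, (E.norm_eq_iInf_iff_real_inner_eq_zero hyE).2
      fun w hw ↦ Submodule.inner_left_of_mem_orthogonal hw hxyE]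
    simp only [dist_eq_norm]
  rw [h_dist, hxy, ← real_inner_self_eq_norm_sq, b.orthonormal.inner_sum]
  simp [sq]

/-- Abstract form of Lemma 2.4 (key contraction property of one step of shifted inverse
iteration): with `E` the sum of the eigenspaces of the symmetric operator `T` over a
nonempty finite cluster `S` of eigenvalues, if `μ₀` is not an eigenvalue of `T`,
every eigenvalue `ν ∉ S` satisfies `|μ₀ − ν| ≥ ρ/2`, `‖u₀‖ = 1`,
`dist(u₀, E) ≤ 1/2`, and `(μ₀·id − T) u' = u₀`, then `u' ≠ 0` and the normalized
vector `u = u'/‖u'‖` satisfies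
`dist(u, E) ≤ (4/ρ)·(max_{ν∈S} |μ₀ − ν|)·dist(u₀, E)`. -/
theorem shifted_inverse_iteration_contraction
    {V : Type*} [NormedAddCommGroup V] [InnerProductSpace ℝ V]
    [FiniteDimensional ℝ V] [Nontrivial V]
    (T : V →ₗ[ℝ] V)
    (hT : ∀ x y : V, ⟪T x, y⟫ = ⟪x, T y⟫)
    (S : Finset ℝ) (hS : S.Nonempty)
    (hSeig : ∀ ν ∈ S, Module.End.HasEigenvalue T ν)
    (E : Submodule ℝ V)
    (hE : E = ⨆ ν ∈ S, Module.End.eigenspace T ν)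
    (μ₀ : ℝ) (hμ₀ : ¬ Module.End.HasEigenvalue T μ₀)
    (ρ : ℝ) (hρ : 0 < ρ)
    (hsep : ∀ ν : ℝ, Module.End.HasEigenvalue T ν → ν ∉ S → ρ / 2 ≤ |μ₀ - ν|)
    (u₀ : V) (hu₀norm : ‖u₀‖ = 1)
    (hu₀dist : Metric.infDist u₀ (E : Set V) ≤ 1 / 2)
    (u' : V) (hu' : μ₀ • u' - T u' = u₀) :
    u' ≠ 0 ∧
      Metric.infDist (‖u'‖⁻¹ • u') (E : Set V) ≤
        4 / ρ * (S.sup' hS fun ν => |μ₀ - ν|) * Metric.infDist u₀ (E : Set V) := by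
  have hTs : T.IsSymmetric := hT
  subst hE
  set b := hTs.eigenvectorBasis rfl
  set l := hTs.eigenvalues rfl
  have hb : ∀ i, T (b i) = l i • b i := hTs.apply_eigenvectorBasis rfl
  have hl : ∀ i, Module.End.HasEigenvalue T (l i) := hTs.hasEigenvalue_eigenvalues rfl
  have h_coord : ∀ i, ⟪b i, u₀⟫ = (μ₀ - l i) * ⟪b i, u'⟫ := by
    intro i
    rw [← hu', inner_sub_right, ← hT, hb, real_inner_smul_left, real_inner_smul_right]
    ring
  have hu'0 : u' ≠ 0 := by
    rintro rfl
    simp [← hu'] at hu₀norm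
  refine ⟨hu'0, ?_⟩
  set M := S.sup' hS fun ν ↦ |μ₀ - ν|
  have hM : ∀ ν ∈ S, |μ₀ - ν| ≤ M := fun ν hν ↦ Finset.le_sup' (fun ν ↦ |μ₀ - ν|) hν
  have hM0 : 0 ≤ M := hS.elim fun ν hν ↦ (abs_nonneg _).trans (hM ν hν)
  have hd₀ := infDist_sq_iSup_eigenspace hTs S b l hb u₀
  have hd := infDist_sq_iSup_eigenspace hTs S b l hb (‖u'‖⁻¹ • u')
  set d₀ := Metric.infDist u₀ _
  set d := Metric.infDist (‖u'‖⁻¹ • u') _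
  have hd₀0 : 0 ≤ d₀ := Metric.infDist_nonneg
  have hd0 : 0 ≤ d := Metric.infDist_nonneg
  have hn : 0 < ‖u'‖ := norm_pos_iff.2 hu'0
  have h_lower : 1 / 2 ≤ M * ‖u'‖ := by
    have h_split := Finset.sum_filter_add_sum_filter_not Finset.univ (l · ∈ S)
      fun i ↦ ⟪b i, u₀⟫ ^ 2
    rw [← hd₀, b.sum_sq_inner_right, hu₀norm] at h_split
    have h_le : ∑ i with l i ∈ S, ⟪b i, u₀⟫ ^ 2 ≤ M ^ 2 * ‖u'‖ ^ 2 := by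
      rw [← b.sum_sq_inner_right u', Finset.mul_sum]
      refine (Finset.sum_le_sum fun i hi ↦ ?_).trans (Finset.sum_le_sum_of_subset_of_nonneg
        (Finset.filter_subset _ _) fun i _ _ ↦ by positivity)
      rw [h_coord, mul_pow, ← sq_abs (μ₀ - l i)]
      have := hM _ (Finset.mem_filter.1 hi).2
      gcongr
    refine (sq_le_sq₀ (by positivity) (by positivity)).1 ?_
    nlinarith
  have h_upper : ρ / 2 * (‖u'‖ * d) ≤ d₀ := by
    refine (sq_le_sq₀ (by positivity) hd₀0).1 ?_
    rw [mul_pow, mul_pow, hd, hd₀, Finset.mul_sum, Finset.mul_sum]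
    refine Finset.sum_le_sum fun i hi ↦ ?_
    have := hsep _ (hl i) (Finset.mem_filter.1 hi).2
    rw [h_coord, real_inner_smul_right, ← mul_pow ‖u'‖, mul_inv_cancel_left₀ hn.ne', mul_pow,
      ← sq_abs (μ₀ - l i)]
    gcongr
  have key : ρ * d ≤ 4 * M * d₀ := by
    calc ρ * d = 2 * ρ * d * (1 / 2) := by ring
      _ ≤ 2 * ρ * d * (M * ‖u'‖) := by gcongr
      _ = 4 * M * (ρ / 2 * (‖u'‖ * d)) := by ring
      _ ≤ 4 * M * d₀ := by gcongr
  calc d ≤ 4 * M * d₀ / ρ := (le_div_iff₀' hρ).2 key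
    _ = 4 / ρ * M * d₀ := by ring
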